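/- arXiv:2508.12850 — 2 statements merged into one kernel-verified Lean document; each statement's English description precedes it below -/
import Mathlib

section
/- Let v* = (C, ζ, z, α, ξ) be a feasible point of the BHO-SVM MPEC with C > 0, (Mα)_i ≠ 0 for every i ∈ {1,…,s}, and K_(Λ3⁺, Λ3⁺) positive definite. Suppose |I_GH3| = 1 and |I_GH4| = 0. Set A₃ = K_(I_GH3, Λ3⁺)·(K_(Λ3⁺, Λ3⁺))⁻¹ (with A₃ = 0 if Λ3⁺ = ∅) and â₃ = K_(I_GH3, Λu)·1 − A₃·K_(Λ3⁺, Λu)·1 ∈ ℝ. Then MPEC-LICQ holds at v* if and only if â₃ ≠ 0. -/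
/-!
STATEMENT 14: At a feasible point of the BHO-SVM MPEC with C > 0, (Mα)ᵢ ≠ 0 for all i,
K_(Λ3⁺,Λ3⁺) positive definite, |I_GH3| = 1 (I_GH3 = {i0}) and |I_GH4| = 0,
MPEC-LICQ holds at v* iff â₃ ≠ 0, where
â₃ = K_(I_GH3,Λu)·1 − K_(I_GH3,Λ3⁺)·(K_(Λ3⁺,Λ3⁺))⁻¹·K_(Λ3⁺,Λu)·1.
-/

noncomputable section

/-- Index of the `2s+2q` complementarity constraint pairs of the BHO-SVM MPEC:
`s` pairs `(ζᵢ, (Mα+z)ᵢ)`, `s` pairs `(zᵢ, 1-ζᵢ)`, `q` pairs `(αᵢ, (Kα-1+ξ)ᵢ)`,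
`q` pairs `(ξᵢ, C-αᵢ)`. -/
abbrev BIdx (s q : ℕ) := Fin s ⊕ Fin s ⊕ Fin q ⊕ Fin q

/-- Variable space of the BHO-SVM MPEC: `v = (C, ζ, z, α, ξ)`. -/
abbrev BVec (s q : ℕ) := ℝ × (Fin s → ℝ) × (Fin s → ℝ) × (Fin q → ℝ) × (Fin q → ℝ)

/-- `H(v) = (ζ, z, α, ξ)`. -/
def bH {s q : ℕ} : BIdx s q → BVec s q → ℝ
  | Sum.inl i, v => v.2.1 i
  | Sum.inr (Sum.inl i), v => v.2.2.1 i
  | Sum.inr (Sum.inr (Sum.inl i)), v => v.2.2.2.1 i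
  | Sum.inr (Sum.inr (Sum.inr i)), v => v.2.2.2.2 i

/-- `G(v) = (Mα+z, 1-ζ, Kα-1+ξ, C·1-α)`. -/
def bG {s q : ℕ} (M : Matrix (Fin s) (Fin q) ℝ) (K : Matrix (Fin q) (Fin q) ℝ) :
    BIdx s q → BVec s q → ℝ
  | Sum.inl i, v => M.mulVec v.2.2.2.1 i + v.2.2.1 i
  | Sum.inr (Sum.inl i), v => 1 - v.2.1 i
  | Sum.inr (Sum.inr (Sum.inl i)), v => K.mulVec v.2.2.2.1 i - 1 + v.2.2.2.2 i
  | Sum.inr (Sum.inr (Sum.inr i)), v => v.1 - v.2.2.2.1 i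

/-- `∇H_i(v)`: the gradients of the (affine) functions `H_i`, as vectors of `BVec s q`. -/
def bGradH {s q : ℕ} : BIdx s q → BVec s q
  | Sum.inl i => (0, Pi.single i 1, 0, 0, 0)
  | Sum.inr (Sum.inl i) => (0, 0, Pi.single i 1, 0, 0)
  | Sum.inr (Sum.inr (Sum.inl i)) => (0, 0, 0, Pi.single i 1, 0)
  | Sum.inr (Sum.inr (Sum.inr i)) => (0, 0, 0, 0, Pi.single i 1)

/-- `∇G_i(v)`: the gradients of the (affine) functions `G_i`, as vectors of `BVec s q`. -/
def bGradG {s q : ℕ} (M : Matrix (Fin s) (Fin q) ℝ) (K : Matrix (Fin q) (Fin q) ℝ) :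
    BIdx s q → BVec s q
  | Sum.inl i => (0, 0, Pi.single i 1, fun j => M i j, 0)
  | Sum.inr (Sum.inl i) => (0, -Pi.single i 1, 0, 0, 0)
  | Sum.inr (Sum.inr (Sum.inl i)) => (0, 0, 0, fun j => K i j, Pi.single i 1)
  | Sum.inr (Sum.inr (Sum.inr i)) => (1, 0, 0, -Pi.single i 1, 0)

/-- The principal submatrix `K_(Λ,Λ)` is positive definite. -/
def posDefOn {q : ℕ} (K : Matrix (Fin q) (Fin q) ℝ) (Λ : Set (Fin q)) : Prop :=
  haveI : Fintype ↥Λ := Fintype.ofFinite ↥Λ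
  Matrix.PosDef (Matrix.of fun i j : ↥Λ => K i.1 j.1)

/-- `âhat K i0 Λp Λcol = K_({i0}, Λcol)·1 − (K_({i0}, Λp)·(K_(Λp,Λp))⁻¹)·K_(Λp, Λcol)·1`.
If `Λp = ∅` the second term vanishes (the convention `A = 0`). -/
def ahat {q : ℕ} (K : Matrix (Fin q) (Fin q) ℝ) (i0 : Fin q)
    (Λp Λcol : Set (Fin q)) : ℝ :=
  haveI : Fintype ↥Λp := Fintype.ofFinite ↥Λp
  haveI : Fintype ↥Λcol := Fintype.ofFinite ↥Λcol
  haveI : DecidableEq ↥Λp := Classical.decEq _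
  (∑ j : ↥Λcol, K i0 j.1) -
    ∑ j : ↥Λcol, ∑ k : ↥Λp,
      Matrix.vecMul (fun t : ↥Λp => K i0 t.1)
        (Matrix.of fun a b : ↥Λp => K a.1 b.1)⁻¹ k * K k.1 j.1

theorem aux_sum_sub {ι N : Type*} [Fintype ι] [AddCommMonoid N] (p : ι → Prop)
    (F : Fintype (Subtype p)) (f : ι → N) (hf : ∀ x, ¬ p x → f x = 0) :
    ∑ a : Subtype p, f a.1 = ∑ x, f x := by
  classical
  rw [← Finset.sum_subtype (Finset.univ.filter p) (by simp) f]
  apply Fintype.sum_subset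
  intro i hi
  simp only [Finset.mem_filter, Finset.mem_univ, true_and]
  by_contra h
  exact hi (hf i h)

theorem aux_uniq {q : ℕ} (K : Matrix (Fin q) (Fin q) ℝ) (L : Set (Fin q)) (h : posDefOn K L)
    (x : Fin q → ℝ) (hx : ∀ i, i ∉ L → x i = 0) (h0 : ∀ j ∈ L, ∑ i, x i * K i j = 0) :
    x = 0 := by
  classical
  unfold posDefOn at h
  let _ : Fintype ↥L := Fintype.ofFinite ↥L
  have hd := h.det_pos.ne'
  have := Matrix.eq_zero_of_vecMul_eq_zero hd (v := fun i : ↥L => x i.1) (by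
    funext j
    rw [Matrix.vecMul, dotProduct]
    simp only [Matrix.of_apply, Pi.zero_apply]
    rw [← h0 j.1 j.2]
    exact aux_sum_sub (fun i => i ∈ L) _ (fun i => x i * K i j.1)
      (fun i hi => by simp [hx i hi]))
  funext i
  by_cases hi : i ∈ L
  · exact congrFun this ⟨i, hi⟩
  · exact hx i hi

theorem aux_W {q : ℕ} (K : Matrix (Fin q) (Fin q) ℝ) (i0 : Fin q) (L U : Set (Fin q))
    (h : posDefOn K L) :
    ∃ W : Fin q → ℝ, (∀ i, i ∉ L → W i = 0) ∧ (∀ j ∈ L, ∑ i, W i * K i j = K i0 j) ∧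
      ∀ g : Fin q → ℝ, (∀ j, j ∉ U → g j = 0) → (∀ j ∈ U, g j = K i0 j - ∑ i, W i * K i j) →
        ahat K i0 L U = ∑ j, g j := by
  classical
  unfold posDefOn at h
  let _ : Fintype ↥L := Fintype.ofFinite ↥L
  let _ : Fintype ↥U := Fintype.ofFinite ↥U
  let _ : DecidableEq ↥L := Classical.decEq _
  have hd := h.det_pos.ne'
  set w : ↥L → ℝ := Matrix.vecMul (fun t : ↥L => K i0 t.1)
        (Matrix.of fun a b : ↥L => K a.1 b.1)⁻¹ with hw
  let W : Fin q → ℝ := fun i => if hi : i ∈ L then w ⟨i, hi⟩ else 0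
  have hW0 : ∀ i, i ∉ L → W i = 0 := fun i hi => by simp [W, hi]
  have hWs : ∀ j, ∑ k : ↥L, w k * K k.1 j = ∑ i, W i * K i j := by
    intro j
    rw [← aux_sum_sub (fun i => i ∈ L) _ (fun i => W i * K i j)
      (fun i hi => by simp [hW0 i hi])]
    apply Finset.sum_congr rfl
    intro k _
    have : W k.1 = w k := by
      simp only [W]
      rw [dif_pos k.2]
    rw [this]
  refine ⟨W, hW0, ?_, ?_⟩
  · intro j hj
    rw [← hWs]
    have : Matrix.vecMul w (Matrix.of fun a b : ↥L => K a.1 b.1) = fun t : ↥L => K i0 t.1 := by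
      rw [hw, Matrix.vecMul_vecMul, Matrix.nonsing_inv_mul _ (isUnit_iff_ne_zero.mpr hd),
        Matrix.vecMul_one]
    exact congrFun this ⟨j, hj⟩
  · intro g hg hgU
    have e : ahat K i0 L U = (∑ j : ↥U, K i0 j.1) - ∑ j : ↥U, ∑ k : ↥L, w k * K k.1 j.1 := rfl
    rw [e, ← aux_sum_sub (fun i => i ∈ U) _ g hg, ← Finset.sum_sub_distrib]
    apply Finset.sum_congr rfl
    intro j _
    rw [hWs, hgU _ j.2]

theorem aux_li {ι V : Type*} [Fintype ι] [AddCommGroup V] [Module ℝ V] (p r : ι → Prop)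
    (u v : ι → V) :
    LinearIndependent ℝ (Sum.elim (fun i : {i // p i} => u i.1) (fun i : {i // r i} => v i.1)) ↔
    ∀ g h : ι → ℝ, (∀ i, ¬ p i → g i = 0) → (∀ i, ¬ r i → h i = 0) →
      ∑ i, g i • u i + ∑ i, h i • v i = 0 → g = 0 ∧ h = 0 := by
  classical
  rw [Fintype.linearIndependent_iff]
  constructor
  · intro H g h hg hh hs
    have := H (Sum.elim (fun i => g i.1) (fun i => h i.1)) (by
      rw [Fintype.sum_sum_type]
      simp only [Sum.elim_inl, Sum.elim_inr]
      rw [aux_sum_sub p _ (fun i => g i • u i) (fun i hi => by simp [hg i hi]),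
        aux_sum_sub r _ (fun i => h i • v i) (fun i hi => by simp [hh i hi]), hs])
    constructor
    · funext i
      by_cases hi : p i
      · exact this (Sum.inl ⟨i, hi⟩)
      · exact hg i hi
    · funext i
      by_cases hi : r i
      · exact this (Sum.inr ⟨i, hi⟩)
      · exact hh i hi
  · intro H c hc
    have hg : ∀ i, ¬ p i → (fun i => if hi : p i then c (Sum.inl ⟨i, hi⟩) else 0) i = 0 :=
      fun i hi => by simp [hi]
    have hh : ∀ i, ¬ r i → (fun i => if hi : r i then c (Sum.inr ⟨i, hi⟩) else 0) i = 0 :=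
      fun i hi => by simp [hi]
    obtain ⟨h1, h2⟩ := H _ _ hg hh (by
      rw [← aux_sum_sub p inferInstance _ (fun i hi => by simp [hi]),
        ← aux_sum_sub r inferInstance _ (fun i hi => by simp [hi]), ← hc,
        Fintype.sum_sum_type]
      congr 1
      · apply Finset.sum_congr rfl
        rintro ⟨i, hi⟩ _
        simp [hi]
      · apply Finset.sum_congr rfl
        rintro ⟨i, hi⟩ _
        simp [hi])
    rintro (⟨i, hi⟩ | ⟨i, hi⟩)
    · have := congrFun h1 i
      simpa [hi] using this
    · have := congrFun h2 i
      simpa [hi] using this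

theorem aux_comb {s q : ℕ} (M : Matrix (Fin s) (Fin q) ℝ) (K : Matrix (Fin q) (Fin q) ℝ)
    (g h : BIdx s q → ℝ) :
    ∑ i, g i • bGradG M K i + ∑ i, h i • bGradH i = 0 ↔
    (∑ i, g (.inr (.inr (.inr i))) = 0) ∧
    (∀ i, h (.inl i) - g (.inr (.inl i)) = 0) ∧
    (∀ i, g (.inl i) + h (.inr (.inl i)) = 0) ∧
    (∀ j, ∑ i, g (.inl i) * M i j + ∑ i, g (.inr (.inr (.inl i))) * K i j
      + h (.inr (.inr (.inl j))) - g (.inr (.inr (.inr j))) = 0) ∧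
    (∀ j, g (.inr (.inr (.inl j))) + h (.inr (.inr (.inr j))) = 0) := by
  have e : ∑ i, g i • bGradG M K i + ∑ i, h i • bGradH i =
    (∑ i, g (.inr (.inr (.inr i))),
     fun i => h (.inl i) - g (.inr (.inl i)),
     fun i => g (.inl i) + h (.inr (.inl i)),
     fun j => ∑ i, g (.inl i) * M i j + ∑ i, g (.inr (.inr (.inl i))) * K i j
      + h (.inr (.inr (.inl j))) - g (.inr (.inr (.inr j))),
     fun j => g (.inr (.inr (.inl j))) + h (.inr (.inr (.inr j)))) := by
    simp only [Fintype.sum_sum_type, bGradG, bGradH]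
    refine Prod.ext ?_ (Prod.ext ?_ (Prod.ext ?_ (Prod.ext ?_ ?_)))
    · simp [Prod.fst_sum, Prod.snd_sum]
    all_goals
      funext j
      simp [Prod.fst_sum, Prod.snd_sum, Finset.sum_apply, Pi.single_apply]
      try ring
  rw [e]
  simp only [Prod.mk_eq_zero, funext_iff, Pi.zero_apply]

theorem bho_licq_iff_ahat3_ne_zero
    (s q r : ℕ) (hs : 0 < s) (hq : 0 < q) (hr : 0 < r)
    (A : Matrix (Fin s) (Fin r) ℝ) (B : Matrix (Fin q) (Fin r) ℝ)
    (M : Matrix (Fin s) (Fin q) ℝ) (K : Matrix (Fin q) (Fin q) ℝ)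
    (hM : M = A * B.transpose) (hK : K = B * B.transpose)
    (C : ℝ) (ζ z : Fin s → ℝ) (α ξ : Fin q → ℝ)
    -- feasibility of v* = (C, ζ, z, α, ξ)
    (hζ : ∀ i, 0 ≤ ζ i) (hG1 : ∀ i, 0 ≤ M.mulVec α i + z i)
    (hc1 : ∀ i, ζ i * (M.mulVec α i + z i) = 0)
    (hz : ∀ i, 0 ≤ z i) (hG2 : ∀ i, 0 ≤ 1 - ζ i) (hc2 : ∀ i, z i * (1 - ζ i) = 0)
    (hα : ∀ i, 0 ≤ α i) (hG3 : ∀ i, 0 ≤ K.mulVec α i - 1 + ξ i)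
    (hc3 : ∀ i, α i * (K.mulVec α i - 1 + ξ i) = 0)
    (hξ : ∀ i, 0 ≤ ξ i) (hG4 : ∀ i, 0 ≤ C - α i) (hc4 : ∀ i, ξ i * (C - α i) = 0)
    -- standing assumptions
    (hC : 0 < C) (hMα : ∀ i, M.mulVec α i ≠ 0)
    -- K_(Λ3⁺, Λ3⁺) positive definite
    (hpd : posDefOn K
      {i : Fin q | 0 < α i ∧ α i < C ∧ K.mulVec α i - 1 + ξ i = 0 ∧ ξ i = 0})
    -- |I_GH3| = 1, with I_GH3 = {i0}
    (i0 : Fin q)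
    (hGH3 : {i : Fin q | α i = 0 ∧ K.mulVec α i - 1 + ξ i = 0} = {i0})
    -- |I_GH4| = 0
    (hGH4 : {i : Fin q | ξ i = 0 ∧ α i = C} = ∅) :
    -- MPEC-LICQ holds at v* iff â₃ ≠ 0
    (LinearIndependent ℝ
      (Sum.elim
        (fun i : {idx : BIdx s q // bG M K idx (C, ζ, z, α, ξ) = 0} => bGradG M K i.1)
        (fun i : {idx : BIdx s q // bH idx (C, ζ, z, α, ξ) = 0} => bGradH i.1)))
    ↔
    ahat K i0
      {i : Fin q | 0 < α i ∧ α i < C ∧ K.mulVec α i - 1 + ξ i = 0 ∧ ξ i = 0}  -- Λ3⁺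
      {i : Fin q | α i = C ∧ K.mulVec α i - 1 + ξ i = 0 ∧ 0 < ξ i}             -- Λu
      ≠ 0 := by
  classical
  rw [aux_li (fun idx => bG M K idx (C, ζ, z, α, ξ) = 0) (fun idx => bH idx (C, ζ, z, α, ξ) = 0)
    (bGradG M K) bGradH]
  set L : Set (Fin q) :=
    {i : Fin q | 0 < α i ∧ α i < C ∧ K.mulVec α i - 1 + ξ i = 0 ∧ ξ i = 0} with hL
  set U : Set (Fin q) :=
    {i : Fin q | α i = C ∧ K.mulVec α i - 1 + ξ i = 0 ∧ 0 < ξ i} with hU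
  have hi0 : α i0 = 0 ∧ K.mulVec α i0 - 1 + ξ i0 = 0 := by
    have : i0 ∈ {i : Fin q | α i = 0 ∧ K.mulVec α i - 1 + ξ i = 0} := by rw [hGH3]; rfl
    exact this
  have hni0 : ∀ j, α j = 0 → K.mulVec α j - 1 + ξ j = 0 → j = i0 := by
    intro j h1 h2
    have : j ∈ {i : Fin q | α i = 0 ∧ K.mulVec α i - 1 + ξ i = 0} := ⟨h1, h2⟩
    rw [hGH3] at this
    exact this
  have h4 : ∀ j, ξ j = 0 → α j ≠ C := by
    intro j h1 h2
    have : j ∈ {i : Fin q | ξ i = 0 ∧ α i = C} := ⟨h1, h2⟩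
    rw [hGH4] at this
    exact this
  have tri : ∀ j, (α j = 0 ∧ ξ j = 0 ∧ C - α j ≠ 0 ∧ j ∉ L ∧ j ∉ U) ∨
      (j ∈ L ∧ j ∉ U ∧ α j ≠ 0 ∧ C - α j ≠ 0 ∧ K.mulVec α j - 1 + ξ j = 0 ∧ ξ j = 0) ∨
      (j ∈ U ∧ j ∉ L ∧ α j ≠ 0 ∧ C - α j = 0 ∧ K.mulVec α j - 1 + ξ j = 0 ∧ ξ j ≠ 0) := by
    intro j
    rcases (hα j).eq_or_lt with h | h
    · left
      have hCa : C - α j ≠ 0 := by rw [← h]; linarith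
      refine ⟨h.symm, (mul_eq_zero.mp (hc4 j)).resolve_right hCa, hCa, ?_, ?_⟩
      · intro hh; have := hh.1; linarith
      · intro hh; have := hh.1; linarith
    · right
      have hG := (mul_eq_zero.mp (hc3 j)).resolve_left h.ne'
      rcases (hG4 j).eq_or_lt with h' | h'
      · right
        have hx : ξ j ≠ 0 := fun hx => h4 j hx (by linarith)
        refine ⟨⟨by linarith, hG, lt_of_le_of_ne (hξ j) (Ne.symm hx)⟩, ?_, h.ne', h'.symm, hG, hx⟩
        intro hh; have := hh.2.1; linarith
      · left
        have hx : ξ j = 0 := (mul_eq_zero.mp (hc4 j)).resolve_right h'.ne'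
        refine ⟨⟨h, by linarith, hG, hx⟩, ?_, h.ne', h'.ne', hG, hx⟩
        intro hh; have := hh.1; linarith
  have hi0L : i0 ∉ L := fun hh => by have := hh.1; linarith [hi0.1]
  obtain ⟨W, hW0, hWL, hWa⟩ := aux_W K i0 L U hpd
  have hSum : ∀ (c : ℝ) (x : Fin q → ℝ) (j : Fin q),
      ∑ i, (c * (if i = i0 then 1 else 0) - x i) * K i j = c * K i0 j - ∑ i, x i * K i j := by
    intro c x j
    simp [sub_mul, Finset.sum_sub_distrib]
  constructor
  · intro H ha
    let g3 : Fin q → ℝ := fun i => 1 * (if i = i0 then 1 else 0) - W i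
    let S : Fin q → ℝ := fun j => K i0 j - ∑ i, W i * K i j
    have hS : ∀ j, ∑ i, g3 i * K i j = S j := fun j => by
      simp only [g3, S]; rw [hSum, one_mul]
    let g4 : Fin q → ℝ := fun j => if j ∈ U then S j else 0
    let h3 : Fin q → ℝ := fun j => if j ∈ L ∨ j ∈ U then 0 else - S j
    let g : BIdx s q → ℝ := Sum.elim 0 (Sum.elim 0 (Sum.elim g3 g4))
    let h : BIdx s q → ℝ := Sum.elim 0 (Sum.elim 0 (Sum.elim h3 (-g3)))
    have hg3 : ∀ j, j ∉ L → j ≠ i0 → g3 j = 0 := fun j h1 h2 => by simp [g3, h2, hW0 j h1]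
    obtain ⟨e1, -⟩ := H g h (by
      rintro (i | i | i | i) hi
      · rfl
      · rfl
      · change g3 i = 0
        change ¬ (K.mulVec α i - 1 + ξ i = 0) at hi
        apply hg3
        · intro hh; exact hi hh.2.2.1
        · rintro rfl; exact hi hi0.2
      · change g4 i = 0
        change ¬ (C - α i = 0) at hi
        apply if_neg
        intro hh; exact hi (by have := hh.1; linarith)) (by
      rintro (i | i | i | i) hi
      · rfl
      · rfl
      · change h3 i = 0
        change ¬ (α i = 0) at hi
        apply if_pos
        rcases tri i with t | t | t
        · exact absurd t.1 hi
        · exact Or.inl t.1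
        · exact Or.inr t.1
      · change - g3 i = 0
        change ¬ (ξ i = 0) at hi
        rw [hg3, neg_zero]
        · intro hh; exact hi hh.2.2.2
        · rintro rfl
          rcases tri i with t | t | t
          · exact hi t.2.1
          · exact hi t.2.2.2.2.2
          · exact t.2.2.1 hi0.1) (by
      rw [aux_comb]
      refine ⟨?_, ?_, ?_, ?_, ?_⟩
      · change ∑ i, g4 i = 0
        rw [← hWa g4 (fun j hj => if_neg hj) (fun j hj => if_pos hj), ha]
      · intro i; simp [g, h]
      · intro i; simp [g, h]
      · intro j
        simp only [g, h, Sum.elim_inl, Sum.elim_inr, Pi.zero_apply, zero_mul,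
          Finset.sum_const_zero, zero_add]
        rw [hS]
        rcases tri j with t | t | t
        · simp [h3, g4, t.2.2.2.1, t.2.2.2.2]
        · simp [h3, g4, t.1, t.2.1, S, hWL j t.1]
        · simp [h3, g4, t.1]
      · intro j; simp [g, h])
    have := congrFun e1 (Sum.inr (Sum.inr (Sum.inl i0)))
    simp [g, g3, hW0 i0 hi0L] at this
  · intro ha g h hg hh hs
    rw [aux_comb] at hs
    obtain ⟨s1, s2, s3, s4, s5⟩ := hs
    have hg1 : ∀ i, M.mulVec α i + z i ≠ 0 → g (.inl i) = 0 := fun i => hg (.inl i)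
    have hg2 : ∀ i, 1 - ζ i ≠ 0 → g (.inr (.inl i)) = 0 := fun i => hg (.inr (.inl i))
    have hg3 : ∀ i, K.mulVec α i - 1 + ξ i ≠ 0 → g (.inr (.inr (.inl i))) = 0 :=
      fun i => hg (.inr (.inr (.inl i)))
    have hg4 : ∀ i, C - α i ≠ 0 → g (.inr (.inr (.inr i))) = 0 :=
      fun i => hg (.inr (.inr (.inr i)))
    have hh1 : ∀ i, ζ i ≠ 0 → h (.inl i) = 0 := fun i => hh (.inl i)
    have hh2 : ∀ i, z i ≠ 0 → h (.inr (.inl i)) = 0 := fun i => hh (.inr (.inl i))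
    have hh3 : ∀ i, α i ≠ 0 → h (.inr (.inr (.inl i))) = 0 :=
      fun i => hh (.inr (.inr (.inl i)))
    have hh4 : ∀ i, ξ i ≠ 0 → h (.inr (.inr (.inr i))) = 0 :=
      fun i => hh (.inr (.inr (.inr i)))
    have key1 : ∀ i, g (.inl i) = 0 ∧ g (.inr (.inl i)) = 0 ∧ h (.inl i) = 0 ∧
        h (.inr (.inl i)) = 0 := by
      intro i
      have a2 := s2 i
      have a3 := s3 i
      rcases lt_or_gt_of_ne (hMα i) with hm | hm
      · have hz0 : z i ≠ 0 := by have := hG1 i; intro h0; linarith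
        have hz1 := (mul_eq_zero.mp (hc2 i)).resolve_left hz0
        have b1 := hh2 i hz0
        have b2 := hh1 i (by intro h0; linarith)
        exact ⟨by linarith, by linarith, b2, b1⟩
      · have hne : M.mulVec α i + z i ≠ 0 := by have := hz i; intro h0; linarith
        have hz1 := (mul_eq_zero.mp (hc1 i)).resolve_right hne
        have b1 := hg1 i hne
        have b2 := hg2 i (by rw [hz1]; norm_num)
        exact ⟨b1, b2, by linarith, by linarith⟩
    set y : Fin q → ℝ := fun j => g (.inr (.inr (.inl j))) with hy
    have s4' : ∀ j, ∑ i, y i * K i j + h (.inr (.inr (.inl j))) = g (.inr (.inr (.inr j))) := by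
      intro j
      have := s4 j
      simp only [fun i => (key1 i).1, zero_mul, Finset.sum_const_zero, zero_add] at this
      exact sub_eq_zero.mp this
    have hyU : ∀ j, j ∉ L → j ≠ i0 → y j = 0 := by
      intro j hj hj0
      rcases tri j with t | t | t
      · exact hg3 j (fun hk => hj0 (hni0 j t.1 hk))
      · exact absurd t.1 hj
      · have := s5 j
        rw [hh4 j t.2.2.2.2.2, add_zero] at this
        exact this
    have hyL : ∀ j ∈ L, ∑ i, y i * K i j = 0 := by
      intro j hj
      rcases tri j with t | t | t
      · exact absurd hj t.2.2.2.1
      · have := s4' j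
        rwa [hh3 j t.2.2.1, hg4 j t.2.2.2.1, add_zero] at this
      · exact absurd hj t.2.1
    have hyW : (fun i => y i - y i0 * (if i = i0 then 1 else 0) + y i0 * W i) = 0 := by
      apply aux_uniq K L hpd
      · intro i hi
        by_cases hii : i = i0
        · subst hii; simp [hW0 i hi]
        · simp [hii, hW0 i hi, hyU i hi hii]
      · intro j hj
        simp only [add_mul, sub_mul, Finset.sum_add_distrib, Finset.sum_sub_distrib]
        rw [hyL j hj]
        simp only [mul_assoc, ← Finset.mul_sum]
        rw [hWL j hj]
        simp
    have hyW' : ∀ i, y i = y i0 * (if i = i0 then 1 else 0) - y i0 * W i := by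
      intro i
      have := congrFun hyW i
      simp only [Pi.zero_apply] at this
      linarith
    have hyS : ∀ j, ∑ i, y i * K i j = y i0 * (K i0 j - ∑ i, W i * K i j) := by
      intro j
      rw [Finset.sum_congr rfl (fun i _ => by rw [hyW' i]), hSum (y i0) (fun i => y i0 * W i) j,
        mul_sub, Finset.mul_sum]
      simp only [mul_assoc]
    have hy0 : y i0 = 0 := by
      have e := hWa (fun j => if j ∈ U then K i0 j - ∑ i, W i * K i j else 0)
        (fun j hj => if_neg hj) (fun j hj => if_pos hj)
      have : y i0 * ahat K i0 L U = 0 := by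
        rw [e, Finset.mul_sum]
        refine Eq.trans ?_ s1
        apply Finset.sum_congr rfl
        intro j _
        rcases tri j with t | t | t
        · rw [hg4 j t.2.2.1, if_neg t.2.2.2.2, mul_zero]
        · rw [hg4 j t.2.2.2.1, if_neg t.2.1, mul_zero]
        · rw [if_pos t.1, ← hyS, ← s4', hh3 j t.2.2.1, add_zero]
      exact (mul_eq_zero.mp this).resolve_right ha
    have hy1 : ∀ i, y i = 0 := fun i => by rw [hyW' i, hy0]; simp
    have s4'' : ∀ j, h (.inr (.inr (.inl j))) = g (.inr (.inr (.inr j))) := by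
      intro j
      rw [← s4' j]
      simp [hy1]
    have key2 : ∀ j, h (.inr (.inr (.inl j))) = 0 := by
      intro j
      rcases tri j with t | t | t
      · rw [s4'', hg4 j t.2.2.1]
      · exact hh3 j t.2.2.1
      · exact hh3 j t.2.2.1
    constructor
    · funext idx
      rcases idx with i | i | i | i
      · exact (key1 i).1
      · exact (key1 i).2.1
      · exact hy1 i
      · exact (s4'' i).symm.trans (key2 i)
    · funext idx
      rcases idx with i | i | i | i
      · exact (key1 i).2.2.1
      · exact (key1 i).2.2.2
      · exact key2 i
      · have := s5 i
        have h1 : g (.inr (.inr (.inl i))) = 0 := hy1 i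
        rw [h1, zero_add] at this
        exact this
end
end

section
/- Let q, r be positive integers, B ∈ ℝ^{q×r}, K = B·Bᵀ, and let Λ2, Λ3⁺, Λ3ᶜ, Λu be pairwise disjoint subsets whose union is {1,…,q}, with |Λ3ᶜ| = 1 and K_(Λ3⁺, Λ3⁺) positive definite (or Λ3⁺ = ∅). Set A₄ = K_(Λ3ᶜ, Λ3⁺)·(K_(Λ3⁺, Λ3⁺))⁻¹ (A₄ = 0 if Λ3⁺ = ∅) and â₄ = K_(Λ3ᶜ, Λ3ᶜ∪Λu)·1 − A₄·K_(Λ3⁺, Λ3ᶜ∪Λu)·1 ∈ ℝ. Then the following vectors in ℝ × ℝ^q × ℝ^q are linearly independent if and only if â₄ ≠ 0: (0, K_{i,·}, e_i) for i ∈ Λ3⁺; (0, K_{i,·}, e_i) for i ∈ Λ3ᶜ; (0, e_i, 0) for i ∈ Λ2; (1, −e_i, 0) for i ∈ Λu; (1, −e_i, 0) for i ∈ Λ3ᶜ; (0, 0, e_i) for i ∈ Λ3ᶜ; and (0, 0, e_i) for i ∈ Λ3⁺, where K_{i,·} is the i-th row of K and e_i is the i-th standard basis vector of ℝ^q. -/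
/-!
STATEMENT 18 (Lemma on Γ_sub3): given pairwise disjoint Λ2, Λ3⁺, Λ3ᶜ, Λu covering
{1,…,q}, with Λ3ᶜ = {i0} and K_(Λ3⁺,Λ3⁺) positive definite (or Λ3⁺ = ∅), the listed
vectors in ℝ × ℝ^q × ℝ^q are linearly independent iff â₄ ≠ 0, where
â₄ = K_(Λ3ᶜ,Λ3ᶜ∪Λu)·1 − K_(Λ3ᶜ,Λ3⁺)·(K_(Λ3⁺,Λ3⁺))⁻¹·K_(Λ3⁺,Λ3ᶜ∪Λu)·1.
-/

noncomputable section

theorem aux_sum_single {q : ℕ} (Λ : Set (Fin q)) [Fintype ↥Λ] (c : ↥Λ → ℝ) (j : Fin q) (h : j ∈ Λ) :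
    ∑ i : ↥Λ, c i * (Pi.single i.1 1 : Fin q → ℝ) j = c ⟨j, h⟩ := by
  classical
  rw [Finset.sum_eq_single ⟨j, h⟩]
  · simp
  · intro b _ hb
    have : j ≠ b.1 := fun e => hb (Subtype.ext e.symm)
    simp [this]
  · simp

theorem aux_sum_single_not {q : ℕ} (Λ : Set (Fin q)) [Fintype ↥Λ] (c : ↥Λ → ℝ) (j : Fin q)
    (h : j ∉ Λ) :
    ∑ i : ↥Λ, c i * (Pi.single i.1 1 : Fin q → ℝ) j = 0 := by
  classical
  apply Finset.sum_eq_zero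
  intro b _
  have : j ≠ b.1 := fun e => h (e ▸ b.2)
  simp [this]

theorem aux_ahat {q : ℕ} (K : Matrix (Fin q) (Fin q) ℝ) (i0 : Fin q) (Λp Λu : Set (Fin q))
    [Fintype ↥Λp] [Fintype ↥Λu] (hu : i0 ∉ Λu)
    (hpd : Λp = ∅ ∨ posDefOn K Λp) :
    ∃ w : ↥Λp → ℝ, (∀ j : ↥Λp, ∑ k, w k * K k.1 j.1 = K i0 j.1) ∧
      (∀ v : ↥Λp → ℝ, (∀ j : ↥Λp, ∑ k, v k * K k.1 j.1 = 0) → v = 0) ∧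
      ahat K i0 Λp ({i0} ∪ Λu) = (K i0 i0 - ∑ k, w k * K k.1 i0) +
        ∑ j : ↥Λu, (K i0 j.1 - ∑ k, w k * K k.1 j.1) := by
  classical
  have hdet : IsUnit (Matrix.of fun a b : ↥Λp => K a.1 b.1).det := by
    rcases hpd with h | h
    · subst h
      simp [Matrix.det_isEmpty]
    · have h' : Matrix.PosDef (Matrix.of fun a b : ↥Λp => K a.1 b.1) := by
        unfold posDefOn at h
        convert h
      exact h'.det_pos.ne'.isUnit
  refine ⟨Matrix.vecMul (fun t : ↥Λp => K i0 t.1) (Matrix.of fun a b : ↥Λp => K a.1 b.1)⁻¹,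
    ?_, ?_, ?_⟩
  · intro j
    have := congrFun (show Matrix.vecMul (Matrix.vecMul (fun t : ↥Λp => K i0 t.1)
      (Matrix.of fun a b : ↥Λp => K a.1 b.1)⁻¹) (Matrix.of fun a b : ↥Λp => K a.1 b.1) =
      (fun t : ↥Λp => K i0 t.1) by
        rw [Matrix.vecMul_vecMul, Matrix.nonsing_inv_mul _ hdet, Matrix.vecMul_one]) j
    exact this
  · intro v hv
    have h0 : Matrix.vecMul v (Matrix.of fun a b : ↥Λp => K a.1 b.1) = 0 := by
      funext j
      exact hv j
    have := congrArg (fun x => Matrix.vecMul x (Matrix.of fun a b : ↥Λp => K a.1 b.1)⁻¹) h0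
    simpa [Matrix.vecMul_vecMul, Matrix.mul_nonsing_inv _ hdet] using this
  · generalize hw : Matrix.vecMul (fun t : ↥Λp => K i0 t.1)
      (Matrix.of fun a b : ↥Λp => K a.1 b.1)⁻¹ = w
    have key : ∀ [Fintype ↥({i0} ∪ Λu)] (f : Fin q → ℝ),
        ∑ j : ↥({i0} ∪ Λu), f j.1 = f i0 + ∑ j : ↥Λu, f j.1 := by
      intro _ f
      rw [← Finset.sum_subtype (Insert.insert i0 Λu.toFinset) (by simp) f,
        Finset.sum_insert (by simpa using hu),
        Finset.sum_subtype (p := fun x => x ∈ Λu) Λu.toFinset (fun x => Set.mem_toFinset) f]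
    have e1 : ahat K i0 Λp ({i0} ∪ Λu) = (∑ j : ↥({i0} ∪ Λu), K i0 j.1) -
        ∑ j : ↥({i0} ∪ Λu), ∑ k : ↥Λp, w k * K k.1 j.1 := by
      subst hw
      unfold ahat
      congr!
    rw [e1, key (fun j => K i0 j), key (fun j => ∑ k : ↥Λp, w k * K k.1 j),
      Finset.sum_sub_distrib]
    ring

theorem gammaSub3_linearIndependent_iff
    (q r : ℕ) (hq : 0 < q) (hr : 0 < r)
    (B : Matrix (Fin q) (Fin r) ℝ) (K : Matrix (Fin q) (Fin q) ℝ)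
    (hK : K = B * B.transpose)
    (Λ2 Λ3p Λ3c Λu : Set (Fin q))
    (h23p : Disjoint Λ2 Λ3p) (h23c : Disjoint Λ2 Λ3c) (h2u : Disjoint Λ2 Λu)
    (h3p3c : Disjoint Λ3p Λ3c) (h3pu : Disjoint Λ3p Λu) (h3cu : Disjoint Λ3c Λu)
    (hcover : Λ2 ∪ Λ3p ∪ Λ3c ∪ Λu = Set.univ)
    (i0 : Fin q) (hΛ3c : Λ3c = {i0})
    (hpd : Λ3p = ∅ ∨ posDefOn K Λ3p) :
    LinearIndependent ℝ
      (Sum.elim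
        (fun i : ↥Λ3p =>
          (((0 : ℝ), fun j => K i.1 j, Pi.single i.1 1) : ℝ × (Fin q → ℝ) × (Fin q → ℝ)))
        (Sum.elim
          (fun i : ↥Λ3c =>
            (((0 : ℝ), fun j => K i.1 j, Pi.single i.1 1) : ℝ × (Fin q → ℝ) × (Fin q → ℝ)))
          (Sum.elim
            (fun i : ↥Λ2 =>
              (((0 : ℝ), Pi.single i.1 1, 0) : ℝ × (Fin q → ℝ) × (Fin q → ℝ)))
            (Sum.elim
              (fun i : ↥Λu =>
                (((1 : ℝ), -Pi.single i.1 1, 0) : ℝ × (Fin q → ℝ) × (Fin q → ℝ)))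
              (Sum.elim
                (fun i : ↥Λ3c =>
                  (((1 : ℝ), -Pi.single i.1 1, 0) : ℝ × (Fin q → ℝ) × (Fin q → ℝ)))
                (Sum.elim
                  (fun i : ↥Λ3c =>
                    (((0 : ℝ), 0, Pi.single i.1 1) : ℝ × (Fin q → ℝ) × (Fin q → ℝ)))
                  (fun i : ↥Λ3p =>
                    (((0 : ℝ), 0, Pi.single i.1 1) : ℝ × (Fin q → ℝ) × (Fin q → ℝ)))))))))
    ↔ ahat K i0 Λ3p (Λ3c ∪ Λu) ≠ 0 := by
  classical
  subst hΛ3c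
  have hu : i0 ∉ Λu := by simpa using h3cu
  have hp0 : i0 ∉ Λ3p := by simpa using h3p3c
  have h20 : i0 ∉ Λ2 := by simpa using h23c
  obtain ⟨w, hw, hinj, hah⟩ := aux_ahat K i0 Λ3p Λu hu hpd
  rw [hah, Fintype.linearIndependent_iff]
  have hmem : ∀ j, j ∈ Λ2 ∨ j ∈ Λ3p ∨ j = i0 ∨ j ∈ Λu := by
    intro j
    have : j ∈ Λ2 ∪ Λ3p ∪ {i0} ∪ Λu := hcover ▸ Set.mem_univ j
    rcases this with ((h | h) | h) | h
    · exact Or.inl h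
    · exact Or.inr (Or.inl h)
    · exact Or.inr (Or.inr (Or.inl h))
    · exact Or.inr (Or.inr (Or.inr h))
  have d2p : ∀ j, j ∈ Λ2 → j ∉ Λ3p := fun j a b => Set.disjoint_left.1 h23p a b
  have d2u : ∀ j, j ∈ Λ2 → j ∉ Λu := fun j a b => Set.disjoint_left.1 h2u a b
  have dpu : ∀ j, j ∈ Λ3p → j ∉ Λu := fun j a b => Set.disjoint_left.1 h3pu a b
  have dp0 : ∀ j, j ∈ Λ3p → j ≠ i0 := fun j a b => hp0 (b ▸ a)
  have d20 : ∀ j, j ∈ Λ2 → j ≠ i0 := fun j a b => h20 (b ▸ a)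
  have du0 : ∀ j, j ∈ Λu → j ≠ i0 := fun j a b => hu (b ▸ a)
  constructor
  · intro H h0
    have := H (Sum.elim (fun k => - w k) (Sum.elim (fun _ => 1)
      (Sum.elim (fun j => -(K i0 j.1 - ∑ k, w k * K k.1 j.1))
      (Sum.elim (fun j => (K i0 j.1 - ∑ k, w k * K k.1 j.1))
      (Sum.elim (fun j => (K i0 j.1 - ∑ k, w k * K k.1 j.1))
      (Sum.elim (fun _ => -1) w)))))) ?_ (Sum.inr (Sum.inl ⟨i0, rfl⟩))
    · simp at this
    simp only [Fintype.sum_sum_type, Sum.elim_inl, Sum.elim_inr]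
    refine Prod.ext ?_ (Prod.ext ?_ ?_)
    · simp [Prod.fst_sum]
      simp at h0
      linarith
    · funext j
      simp only [Prod.fst_add, Prod.snd_add, Prod.snd_sum, Prod.fst_sum, Prod.smul_fst,
        Prod.smul_snd, Pi.add_apply, Finset.sum_apply, Pi.smul_apply, smul_eq_mul, Pi.neg_apply,
        mul_neg, Finset.sum_neg_distrib, Prod.snd_zero, Prod.fst_zero, Pi.zero_apply, mul_zero,
        neg_mul, Finset.sum_const_zero, Finset.univ_unique, Finset.sum_singleton,
        Set.default_coe_singleton, one_mul]
      rcases hmem j with h | h | h | h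
      · rw [aux_sum_single Λ2 (fun i => _) j h, aux_sum_single_not Λu (fun i => _) j (d2u j h)]
        simp [d20 j h]
      · rw [aux_sum_single_not Λ2 (fun i => _) j (fun h' => d2p j h' h),
          aux_sum_single_not Λu (fun i => _) j (dpu j h)]
        have := hw ⟨j, h⟩
        simp only at this
        simp [dp0 j h, this]
      · subst h
        rw [aux_sum_single_not Λ2 (fun i => _) j h20, aux_sum_single_not Λu (fun i => _) j hu]
        simp
      · rw [aux_sum_single_not Λ2 (fun i => _) j (fun h' => d2u j h' h),
          aux_sum_single Λu (fun i => _) j h]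
        simp [du0 j h]
    · funext j
      simp [Prod.snd_sum]
  · intro hne g hg
    obtain ⟨g1, hg1⟩ : ∃ f, f = fun i => g (Sum.inl i) := ⟨_, rfl⟩
    obtain ⟨g2, hg2⟩ : ∃ f, f = fun i => g (Sum.inr (Sum.inl i)) := ⟨_, rfl⟩
    obtain ⟨g3, hg3⟩ : ∃ f, f = fun i => g (Sum.inr (Sum.inr (Sum.inl i))) := ⟨_, rfl⟩
    obtain ⟨g4, hg4⟩ : ∃ f, f = fun i => g (Sum.inr (Sum.inr (Sum.inr (Sum.inl i)))) := ⟨_, rfl⟩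
    obtain ⟨g5, hg5⟩ : ∃ f, f = fun i => g (Sum.inr (Sum.inr (Sum.inr (Sum.inr (Sum.inl i))))) :=
      ⟨_, rfl⟩
    obtain ⟨g6, hg6⟩ : ∃ f, f = fun i => g (Sum.inr (Sum.inr (Sum.inr (Sum.inr (Sum.inr
      (Sum.inl i)))))) := ⟨_, rfl⟩
    obtain ⟨g7, hg7⟩ : ∃ f, f = fun i => g (Sum.inr (Sum.inr (Sum.inr (Sum.inr (Sum.inr
      (Sum.inr i)))))) := ⟨_, rfl⟩
    have hgg : g = Sum.elim g1 (Sum.elim g2 (Sum.elim g3 (Sum.elim g4 (Sum.elim g5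
        (Sum.elim g6 g7))))) := by
      subst hg1 hg2 hg3 hg4 hg5 hg6 hg7
      funext i
      rcases i with i | i | i | i | i | i | i <;> rfl
    clear hg1 hg2 hg3 hg4 hg5 hg6 hg7
    subst hgg
    simp only [Fintype.sum_sum_type, Sum.elim_inl, Sum.elim_inr, Finset.univ_unique,
      Finset.sum_singleton, Set.default_coe_singleton] at hg
    have hC := congrArg Prod.fst hg
    have hA := fun j => congrFun (congrArg (fun x => x.2.1) hg) j
    have hX := fun j => congrFun (congrArg (fun x => x.2.2) hg) j
    clear hg
    simp only [Prod.fst_add, Prod.snd_add, Prod.snd_sum, Prod.fst_sum, Prod.smul_fst,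
        Prod.smul_snd, Pi.add_apply, Finset.sum_apply, Pi.smul_apply, smul_eq_mul, Pi.neg_apply,
        mul_neg, Finset.sum_neg_distrib, Prod.snd_zero, Prod.fst_zero, Pi.zero_apply, mul_zero,
        Finset.sum_const_zero, mul_one, add_zero, zero_add] at hC hA hX
    obtain ⟨b, hb⟩ : ∃ b, b = g2 ⟨i0, rfl⟩ := ⟨_, rfl⟩
    have hbb : g2 default = b := hb.symm
    have e1 : ∀ k, g1 k = - b * w k := by
      have := hinj (fun k => g1 k + b * w k) (by
        intro j
        have h := hA j.1
        rw [aux_sum_single_not Λ2 _ j.1 (fun h' => d2p j.1 h' j.2),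
          aux_sum_single_not Λu _ j.1 (dpu j.1 j.2)] at h
        simp [dp0 j.1 j.2] at h
        simp only [add_mul, Finset.sum_add_distrib, mul_assoc, ← Finset.mul_sum, hw j]
        rw [hb]
        exact h)
      intro k
      have := congrFun this k
      simp at this
      linarith
    have es : ∀ j, ∑ k, g1 k * K k.1 j = - b * ∑ k, w k * K k.1 j := by
      intro j
      simp only [e1, Finset.mul_sum, mul_assoc]
    have e4 : ∀ j : ↥Λu, g4 j = b * (K i0 j.1 - ∑ k, w k * K k.1 j.1) := by
      intro j
      have h := hA j.1
      rw [aux_sum_single_not Λ2 _ j.1 (fun h' => d2u j.1 h' j.2),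
          aux_sum_single Λu _ j.1 j.2, es, ← hb] at h
      simp [du0 j.1 j.2] at h
      linarith
    have e5 : g5 ⟨i0, rfl⟩ = b * (K i0 i0 - ∑ k, w k * K k.1 i0) := by
      have h := hA i0
      rw [aux_sum_single_not Λ2 _ i0 h20, aux_sum_single_not Λu _ i0 hu, es, ← hb] at h
      simp at h
      linarith
    have hb0 : b = 0 := by
      rw [e5] at hC
      simp only [e4, ← Finset.mul_sum] at hC
      have : b * ((K i0 i0 - ∑ k, w k * K k.1 i0) +
        ∑ j : ↥Λu, (K i0 j.1 - ∑ k, w k * K k.1 j.1)) = 0 := by linarith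
      exact (mul_eq_zero.1 this).resolve_right hne
    rw [hb0] at e1 e4 e5 es
    have e3 : ∀ j, g3 j = 0 := by
      intro j
      have h := hA j.1
      rw [aux_sum_single Λ2 _ j.1 j.2, aux_sum_single_not Λu _ j.1 (d2u j.1 j.2), es,
        ← hb, hb0] at h
      simpa [d20 j.1 j.2] using h
    have e7 : ∀ j, g7 j = 0 := by
      intro j
      have h := hX j.1
      rw [aux_sum_single Λ3p g1 j.1 j.2, aux_sum_single Λ3p g7 j.1 j.2] at h
      simpa [dp0 j.1 j.2, e1] using h
    have e6 : g6 ⟨i0, rfl⟩ = 0 := by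
      have h := hX i0
      rw [aux_sum_single_not Λ3p g1 i0 hp0, aux_sum_single_not Λ3p g7 i0 hp0, ← hb, hb0] at h
      simpa using h
    rintro (i | i | i | i | i | i | i)
    · simp [e1]
    · obtain ⟨i, rfl⟩ := i
      exact hb.symm.trans hb0
    · exact e3 i
    · simp [e4]
    · obtain ⟨i, rfl⟩ := i
      exact e5.trans (zero_mul _)
    · obtain ⟨i, rfl⟩ := i
      exact e6
    · exact e7 i
end
end
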